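/- There exists a constant C > 0, depending only on n and Λ, such that every solution φ satisfies the interior energy (Caccioppoli-type) estimate ∫_{B_{3/4}} |∇φ(x)|² dx ≤ C κ² e^{2Λκ}. -/

import Mathlib

open MeasureTheory Metric Real Set

/-- A (weak) solution of the quasilinear elliptic equation
`-∂ⱼ(aᵢⱼ(x,φ)∂ᵢφ) = ρ(x,φ)[1 - (1/2) f e^φ + F(x,φ,∇φ)]` on the unit ball `B₁ ⊆ ℝⁿ`,
which is continuously differentiable and satisfies `0 ≤ φ ≤ κ`. -/
def IsSolution (n : ℕ) (κ : ℝ)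
    (a : Fin n → Fin n → EuclideanSpace ℝ (Fin n) → ℝ → ℝ)
    (ρ : EuclideanSpace ℝ (Fin n) → ℝ → ℝ)
    (f : EuclideanSpace ℝ (Fin n) → ℝ)
    (F : EuclideanSpace ℝ (Fin n) → ℝ → EuclideanSpace ℝ (Fin n) → ℝ)
    (φ : EuclideanSpace ℝ (Fin n) → ℝ) : Prop :=
  ContDiffOn ℝ 1 φ (ball (0 : EuclideanSpace ℝ (Fin n)) 1) ∧
  (∀ x ∈ ball (0 : EuclideanSpace ℝ (Fin n)) 1, 0 ≤ φ x ∧ φ x ≤ κ) ∧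
  ∀ ψ : EuclideanSpace ℝ (Fin n) → ℝ,
    ContDiff ℝ (⊤ : ℕ∞) ψ → HasCompactSupport ψ →
    tsupport ψ ⊆ ball (0 : EuclideanSpace ℝ (Fin n)) 1 →
    (∫ x in ball (0 : EuclideanSpace ℝ (Fin n)) 1,
        ∑ i : Fin n, ∑ j : Fin n,
          a i j x (φ x) * fderiv ℝ φ x (EuclideanSpace.single i 1) *
            fderiv ℝ ψ x (EuclideanSpace.single j 1))
      = ∫ x in ball (0 : EuclideanSpace ℝ (Fin n)) 1,
          ρ x (φ x) * (1 - (1/2) * f x * Real.exp (φ x) + F x (φ x) (gradient φ x)) * ψ x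

/-- Structural assumptions on the coefficients: symmetry and `Λ`-ellipticity of `aᵢⱼ`,
`1/2 ≤ ρ ≤ 2`, `0 ≤ f ≤ 1`, the natural growth bound `|F(x,z,p)| ≤ |p|² + 1`,
and continuity of all coefficients. -/
def GoodCoeffs (n : ℕ) (Λ : ℝ)
    (a : Fin n → Fin n → EuclideanSpace ℝ (Fin n) → ℝ → ℝ)
    (ρ : EuclideanSpace ℝ (Fin n) → ℝ → ℝ)
    (f : EuclideanSpace ℝ (Fin n) → ℝ)
    (F : EuclideanSpace ℝ (Fin n) → ℝ → EuclideanSpace ℝ (Fin n) → ℝ) : Prop :=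
  (∀ i j, ContinuousOn (fun p : EuclideanSpace ℝ (Fin n) × ℝ => a i j p.1 p.2)
      ((ball (0 : EuclideanSpace ℝ (Fin n)) 1) ×ˢ (Set.univ : Set ℝ))) ∧
  (∀ i j x z, a i j x z = a j i x z) ∧
  (∀ x ∈ ball (0 : EuclideanSpace ℝ (Fin n)) 1, ∀ z : ℝ, ∀ ξ : EuclideanSpace ℝ (Fin n),
      Λ⁻¹ * ‖ξ‖ ^ 2 ≤ ∑ i : Fin n, ∑ j : Fin n, a i j x z * ξ i * ξ j ∧
      ∑ i : Fin n, ∑ j : Fin n, a i j x z * ξ i * ξ j ≤ Λ * ‖ξ‖ ^ 2) ∧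
  ContinuousOn (fun p : EuclideanSpace ℝ (Fin n) × ℝ => ρ p.1 p.2)
      ((ball (0 : EuclideanSpace ℝ (Fin n)) 1) ×ˢ (Set.univ : Set ℝ)) ∧
  (∀ x ∈ ball (0 : EuclideanSpace ℝ (Fin n)) 1, ∀ z : ℝ, 1/2 ≤ ρ x z ∧ ρ x z ≤ 2) ∧
  ContinuousOn f (ball (0 : EuclideanSpace ℝ (Fin n)) 1) ∧
  (∀ x ∈ ball (0 : EuclideanSpace ℝ (Fin n)) 1, 0 ≤ f x ∧ f x ≤ 1) ∧
  ContinuousOn (fun p : EuclideanSpace ℝ (Fin n) × ℝ × EuclideanSpace ℝ (Fin n) =>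
      F p.1 p.2.1 p.2.2)
      ((ball (0 : EuclideanSpace ℝ (Fin n)) 1) ×ˢ
        (Set.univ : Set (ℝ × EuclideanSpace ℝ (Fin n)))) ∧
  (∀ x ∈ ball (0 : EuclideanSpace ℝ (Fin n)) 1, ∀ (z : ℝ) (p : EuclideanSpace ℝ (Fin n)),
      |F x z p| ≤ ‖p‖ ^ 2 + 1)


/-- Mollification of a compactly supported `C¹` function. -/
theorem exists_smooth_approx {n : ℕ} (ψ : EuclideanSpace ℝ (Fin n) → ℝ) (hψ : ContDiff ℝ 1 ψ)
    (hc : HasCompactSupport ψ) (r s : ℝ) (hrs : r < s)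
    (hr : Function.support ψ ⊆ closedBall 0 r) (ε : ℝ) (hε : 0 < ε) :
    ∃ ψ' : EuclideanSpace ℝ (Fin n) → ℝ, ContDiff ℝ (⊤ : ℕ∞) ψ' ∧
      tsupport ψ' ⊆ closedBall 0 s ∧ (∀ x, |ψ' x - ψ x| ≤ ε) ∧
      ∀ x, ‖fderiv ℝ ψ' x - fderiv ℝ ψ x‖ ≤ ε := by
  have huc := hc.uniformContinuous_of_continuous hψ.continuous
  have hdc : Continuous (fderiv ℝ ψ) := hψ.continuous_fderiv (by norm_num)
  have hucd := (hc.fderiv (𝕜 := ℝ)).uniformContinuous_of_continuous hdc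
  rw [Metric.uniformContinuous_iff] at huc hucd
  obtain ⟨d1, hd1, h1⟩ := huc ε hε
  obtain ⟨d2, hd2, h2⟩ := hucd ε hε
  obtain ⟨d, hd, hdd⟩ : ∃ d, 0 < d ∧ d ≤ d1 ∧ d ≤ d2 ∧ d ≤ s - r :=
    ⟨min d1 (min d2 (s - r)), by
      refine lt_min hd1 (lt_min hd2 (by linarith)), min_le_left _ _,
      (min_le_right _ _).trans (min_le_left _ _), (min_le_right _ _).trans (min_le_right _ _)⟩
  let b : ContDiffBump (0 : EuclideanSpace ℝ (Fin n)) := ⟨d / 2, d, by linarith, by linarith⟩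
  have hbr : b.rOut = d := rfl
  refine ⟨convolution (b.normed volume) ψ (ContinuousLinearMap.lsmul ℝ ℝ) volume, ?_, ?_, ?_, ?_⟩
  · exact b.hasCompactSupport_normed.contDiff_convolution_left _ b.contDiff_normed
      hψ.continuous.locallyIntegrable
  · refine closure_minimal ?_ isClosed_closedBall
    refine (support_convolution_subset _).trans ?_
    rw [b.support_normed_eq]
    rintro _ ⟨x, hx, y, hy, rfl⟩
    have hy' := hr hy
    simp only [mem_ball, mem_closedBall, dist_zero_right, hbr] at hx hy' ⊢
    linarith [norm_add_le x y, hdd.2.2]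
  · intro x
    rw [← Real.dist_eq]
    refine b.dist_normed_convolution_le hψ.continuous.aestronglyMeasurable fun y hy => ?_
    exact (h1 (lt_of_lt_of_le hy (by rw [hbr]; exact hdd.1))).le
  · intro x
    have hf := (hc.hasFDerivAt_convolution_right (ContinuousLinearMap.lsmul ℝ ℝ)
      (b.continuous_normed (μ := volume)).locallyIntegrable hψ x (μ := volume)).fderiv
    rw [hf, ← dist_eq_norm]
    have : convolution (b.normed volume) (fderiv ℝ ψ)
        (ContinuousLinearMap.precompR _ (ContinuousLinearMap.lsmul ℝ ℝ)) volume x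
        = convolution (b.normed volume) (fderiv ℝ ψ)
        (ContinuousLinearMap.lsmul ℝ ℝ) volume x := by
      unfold convolution
      congr 1
    rw [this]
    refine b.dist_normed_convolution_le hdc.aestronglyMeasurable fun y hy => ?_
    exact (h2 (lt_of_lt_of_le hy (by rw [hbr]; exact hdd.2.1))).le

theorem integrableOn_ball_of_support {n : ℕ} (u : EuclideanSpace ℝ (Fin n) → ℝ)
    (hu : ContinuousOn u (ball 0 1)) (s : ℝ) (hs : s < 1)
    (h0 : ∀ x, x ∉ closedBall (0 : EuclideanSpace ℝ (Fin n)) s → u x = 0) :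
    IntegrableOn u (ball 0 1) := by
  have h1 : IntegrableOn u (closedBall 0 s) :=
    (hu.mono (closedBall_subset_ball hs)).integrableOn_compact (isCompact_closedBall _ _)
  exact ((integrableOn_iff_integrable_of_support_subset
    (fun x hx => by by_contra h; exact hx (h0 x h))).1 h1).integrableOn

theorem tendsto_pair {n : ℕ} (u : EuclideanSpace ℝ (Fin n) → ℝ)
    (hu : ContinuousOn u (ball 0 1)) (s : ℝ) (hs : s < 1)
    (w : EuclideanSpace ℝ (Fin n) → ℝ) (hw : Continuous w)
    (h0 : ∀ x, x ∉ closedBall (0 : EuclideanSpace ℝ (Fin n)) s → w x = 0)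
    (wk : ℕ → EuclideanSpace ℝ (Fin n) → ℝ) (hwk : ∀ k, Continuous (wk k))
    (h0k : ∀ k x, x ∉ closedBall (0 : EuclideanSpace ℝ (Fin n)) s → wk k x = 0)
    (hlim : ∀ k x, |wk k x - w x| ≤ 1 / ((k : ℝ) + 1)) :
    Filter.Tendsto (fun k => ∫ x in ball (0 : EuclideanSpace ℝ (Fin n)) 1, u x * wk k x)
      Filter.atTop (nhds (∫ x in ball (0 : EuclideanSpace ℝ (Fin n)) 1, u x * w x)) := by
  have hsub := closedBall_subset_ball (x := (0 : EuclideanSpace ℝ (Fin n))) hs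
  have hred : ∀ v : EuclideanSpace ℝ (Fin n) → ℝ,
      (∀ x, x ∉ closedBall (0 : EuclideanSpace ℝ (Fin n)) s → v x = 0) →
      ∫ x in ball (0 : EuclideanSpace ℝ (Fin n)) 1, u x * v x
        = ∫ x in closedBall (0 : EuclideanSpace ℝ (Fin n)) s, u x * v x := fun v hv =>
    setIntegral_eq_of_subset_of_forall_sdiff_eq_zero measurableSet_ball hsub
      (fun x hx => by rw [hv x hx.2, mul_zero])
  rw [hred w h0]
  simp_rw [fun k => hred (wk k) (h0k k)]
  have hu' := hu.mono hsub
  refine tendsto_integral_of_dominated_convergence (fun x => |u x| * (|w x| + 1)) ?_ ?_ ?_ ?_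
  · intro k
    exact (hu'.mul (hwk k).continuousOn).aestronglyMeasurable measurableSet_closedBall
  · exact ContinuousOn.integrableOn_compact (isCompact_closedBall _ _)
      (hu'.abs.mul (hw.abs.add continuous_const).continuousOn)
  · intro k
    refine Filter.Eventually.of_forall fun x => ?_
    rw [Real.norm_eq_abs, abs_mul]
    gcongr
    have h1 : 1 / ((k : ℝ) + 1) ≤ 1 := by
      rw [div_le_one (by positivity)]; linarith [(Nat.cast_nonneg k : (0:ℝ) ≤ k)]
    have := abs_sub_abs_le_abs_sub (wk k x) (w x)
    linarith [hlim k x]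
  · refine Filter.Eventually.of_forall fun x => ?_
    refine Filter.Tendsto.const_mul _ ?_
    rw [tendsto_iff_dist_tendsto_zero]
    exact squeeze_zero (fun _ => dist_nonneg) (fun k => by rw [Real.dist_eq]; exact hlim k x)
      tendsto_one_div_add_atTop_nhds_zero_nat

/-- The weak formulation extends to compactly supported `C¹` test functions. -/
theorem weak_form_C1 {n : ℕ} (V : Fin n → EuclideanSpace ℝ (Fin n) → ℝ)
    (g : EuclideanSpace ℝ (Fin n) → ℝ)
    (hV : ∀ j, ContinuousOn (V j) (ball 0 1)) (hg : ContinuousOn g (ball 0 1))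
    (H : ∀ ψ : EuclideanSpace ℝ (Fin n) → ℝ,
      ContDiff ℝ (⊤ : ℕ∞) ψ → HasCompactSupport ψ →
      tsupport ψ ⊆ ball (0 : EuclideanSpace ℝ (Fin n)) 1 →
      (∫ x in ball (0 : EuclideanSpace ℝ (Fin n)) 1,
        ∑ j : Fin n, V j x * fderiv ℝ ψ x (EuclideanSpace.single j 1))
      = ∫ x in ball (0 : EuclideanSpace ℝ (Fin n)) 1, g x * ψ x)
    (ψ : EuclideanSpace ℝ (Fin n) → ℝ) (hψ : ContDiff ℝ 1 ψ) (r : ℝ) (hr1 : r < 1)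
    (hr : Function.support ψ ⊆ closedBall 0 r) :
    (∫ x in ball (0 : EuclideanSpace ℝ (Fin n)) 1,
        ∑ j : Fin n, V j x * fderiv ℝ ψ x (EuclideanSpace.single j 1))
      = ∫ x in ball (0 : EuclideanSpace ℝ (Fin n)) 1, g x * ψ x := by
  have hts : tsupport ψ ⊆ closedBall 0 r := closure_minimal hr isClosed_closedBall
  have hc : HasCompactSupport ψ :=
    HasCompactSupport.of_support_subset_isCompact (isCompact_closedBall _ _) hr
  obtain ⟨s, hrs, hs⟩ := exists_between hr1
  choose ψk hk1 hk2 hk3 hk4 using fun k : ℕ =>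
    exists_smooth_approx ψ hψ hc r s hrs hr (1 / ((k : ℝ) + 1)) (by positivity)
  have key : ∀ (v : EuclideanSpace ℝ (Fin n) → ℝ), ContDiff ℝ 1 v → tsupport v ⊆ closedBall 0 s →
      (∀ x, x ∉ closedBall (0 : EuclideanSpace ℝ (Fin n)) s → v x = 0) ∧
      (∀ x, x ∉ closedBall (0 : EuclideanSpace ℝ (Fin n)) s → fderiv ℝ v x = 0) ∧
      Continuous (fderiv ℝ v) := by
    intro v hv hvs
    refine ⟨fun x hx => image_eq_zero_of_notMem_tsupport fun h => hx (hvs h), fun x hx => ?_,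
      hv.continuous_fderiv (by norm_num)⟩
    exact image_eq_zero_of_notMem_tsupport fun h => hx (hvs (tsupport_fderiv_subset ℝ h))
  have kψ := key ψ hψ (hts.trans (closedBall_subset_closedBall hrs.le))
  have kk := fun k => key (ψk k) ((hk1 k).of_le (by exact_mod_cast le_top)) (hk2 k)
  have hsum : ∀ (v : EuclideanSpace ℝ (Fin n) → ℝ),
      (∀ x, x ∉ closedBall (0 : EuclideanSpace ℝ (Fin n)) s → fderiv ℝ v x = 0) →
      Continuous (fderiv ℝ v) →
      (∫ x in ball (0 : EuclideanSpace ℝ (Fin n)) 1,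
        ∑ j : Fin n, V j x * fderiv ℝ v x (EuclideanSpace.single j 1)) =
      ∑ j : Fin n, ∫ x in ball (0 : EuclideanSpace ℝ (Fin n)) 1,
        V j x * fderiv ℝ v x (EuclideanSpace.single j 1) := by
    intro v h1 h2
    refine integral_finsetSum _ fun j _ => ?_
    refine integrableOn_ball_of_support _ ((hV j).mul (h2.clm_apply continuous_const).continuousOn)
      s hs fun x hx => ?_
    simp [h1 x hx]
  have hlimL : Filter.Tendsto (fun k => ∫ x in ball (0 : EuclideanSpace ℝ (Fin n)) 1,
        ∑ j : Fin n, V j x * fderiv ℝ (ψk k) x (EuclideanSpace.single j 1)) Filter.atTop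
      (nhds (∫ x in ball (0 : EuclideanSpace ℝ (Fin n)) 1,
        ∑ j : Fin n, V j x * fderiv ℝ ψ x (EuclideanSpace.single j 1))) := by
    rw [hsum ψ kψ.2.1 kψ.2.2]
    simp_rw [fun k => hsum (ψk k) (kk k).2.1 (kk k).2.2]
    refine tendsto_finsetSum _ fun j _ => ?_
    refine tendsto_pair (V j) (hV j) s hs (fun x => fderiv ℝ ψ x (EuclideanSpace.single j 1))
      (kψ.2.2.clm_apply continuous_const) (fun x hx => by simp [kψ.2.1 x hx])
      (fun k x => fderiv ℝ (ψk k) x (EuclideanSpace.single j 1))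
      (fun k => (kk k).2.2.clm_apply continuous_const) (fun k x hx => by simp [(kk k).2.1 x hx])
      fun k x => ?_
    have h1 := (fderiv ℝ (ψk k) x - fderiv ℝ ψ x).le_opNorm (EuclideanSpace.single j 1)
    simp only [ContinuousLinearMap.sub_apply, Real.norm_eq_abs, EuclideanSpace.norm_single,
      abs_one, mul_one] at h1
    exact h1.trans (hk4 k x)
  have hlimR := tendsto_pair g hg s hs ψ hψ.continuous kψ.1 ψk (fun k => (hk1 k).continuous)
    (fun k => (kk k).1) hk3
  refine tendsto_nhds_unique hlimL (hlimR.congr fun k => ?_)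
  exact (H (ψk k) (hk1 k) (HasCompactSupport.of_support_subset_isCompact
    (isCompact_closedBall 0 s) ((subset_tsupport _).trans (hk2 k)))
    ((hk2 k).trans (closedBall_subset_ball hs))).symm

theorem pointwise_bound {n : ℕ} (Λ : ℝ) (hΛ : 1 ≤ Λ) (A : Fin n → Fin n → ℝ)
    (hsym : ∀ i j, A i j = A j i)
    (hell : ∀ ξ : EuclideanSpace ℝ (Fin n),
      Λ⁻¹ * ‖ξ‖ ^ 2 ≤ ∑ i : Fin n, ∑ j : Fin n, A i j * ξ i * ξ j ∧
      ∑ i : Fin n, ∑ j : Fin n, A i j * ξ i * ξ j ≤ Λ * ‖ξ‖ ^ 2)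
    (p q : EuclideanSpace ℝ (Fin n)) (η κ h M R : ℝ) (hκ : 1 ≤ κ) (h1 : 1 ≤ h) (hM : h ≤ M)
    (hR : R ≤ 4 + 2 * ‖p‖ ^ 2) :
    (2 * Λ * κ)⁻¹ * (η ^ 2 * ‖p‖ ^ 2) - M * (κ * (4 * η ^ 2 + 2 * Λ * ‖q‖ ^ 2)) ≤
      (∑ j : Fin n, (∑ i : Fin n, A i j * p i) * (h * ((2 * Λ + κ⁻¹) * η ^ 2 * p j + 2 * η * q j)))
        - R * (η ^ 2 * h) := by
  set P := ∑ i : Fin n, ∑ j : Fin n, A i j * p i * p j with hP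
  set Q := ∑ i : Fin n, ∑ j : Fin n, A i j * q i * q j with hQ
  set X := ∑ i : Fin n, ∑ j : Fin n, A i j * p i * q j with hX
  have hX' : ∑ i : Fin n, ∑ j : Fin n, A i j * q i * p j = X := by
    rw [hX, Finset.sum_comm]
    refine Finset.sum_congr rfl fun i _ => Finset.sum_congr rfl fun j _ => ?_
    rw [hsym j i]; ring
  have hL : (∑ j : Fin n, (∑ i : Fin n, A i j * p i) *
      (h * ((2 * Λ + κ⁻¹) * η ^ 2 * p j + 2 * η * q j)))
      = h * ((2 * Λ + κ⁻¹) * η ^ 2 * P + 2 * η * X) := by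
    rw [hP, hX]
    rw [Finset.sum_comm (f := fun i j => A i j * p i * p j),
      Finset.sum_comm (f := fun i j => A i j * p i * q j)]
    simp only [Finset.mul_sum, Finset.sum_mul, ← Finset.sum_add_distrib]
    refine Finset.sum_congr rfl fun i _ => Finset.sum_congr rfl fun j _ => ?_
    ring
  have hpos : 0 ≤ (κ⁻¹ * η) ^ 2 * P + 4 * (κ⁻¹ * η) * X + 4 * Q := by
    have h2 := (hell ((κ⁻¹ * η) • p + (2 : ℝ) • q)).1
    have h3 : ∑ i : Fin n, ∑ j : Fin n, A i j * ((κ⁻¹ * η) • p + (2 : ℝ) • q) i *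
        ((κ⁻¹ * η) • p + (2 : ℝ) • q) j
        = (κ⁻¹ * η) ^ 2 * P + 2 * (κ⁻¹ * η) * X + 2 * (κ⁻¹ * η) * X + 4 * Q := by
      nth_rewrite 2 [← hX']
      rw [hP, hX, hQ]
      simp only [Finset.mul_sum, ← Finset.sum_add_distrib]
      refine Finset.sum_congr rfl fun i _ => Finset.sum_congr rfl fun j _ => ?_
      simp only [PiLp.add_apply, PiLp.smul_apply, smul_eq_mul]
      ring
    rw [h3] at h2
    have : 0 ≤ Λ⁻¹ * ‖(κ⁻¹ * η) • p + (2 : ℝ) • q‖ ^ 2 := by positivity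
    linarith
  have hPl := (hell p).1
  have hQu := (hell q).2
  have hΛ0 : 0 < Λ := by linarith
  have hκ0 : 0 < κ := by linarith
  have hPn : ‖p‖ ^ 2 ≤ Λ * P := by
    rw [inv_mul_le_iff₀ hΛ0] at hPl; exact hPl
  have hP0 : 0 ≤ P := by nlinarith [sq_nonneg ‖p‖]
  have hc : 0 ≤ κ⁻¹ / 2 * (η ^ 2 * P) + 2 * η * X + 2 * κ * Q := by
    have := mul_nonneg (by positivity : 0 ≤ κ / 2) hpos
    have e : κ / 2 * ((κ⁻¹ * η) ^ 2 * P + 4 * (κ⁻¹ * η) * X + 4 * Q)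
      = κ⁻¹ / 2 * (η ^ 2 * P) + 2 * η * X + 2 * κ * Q := by
      field_simp
      ring
    linarith
  rw [hL]
  have hR' : R * (η ^ 2 * h) ≤ (4 + 2 * (Λ * P)) * (η ^ 2 * h) := by
    gcongr; linarith
  have s1 : (2 * Λ * κ)⁻¹ * (η ^ 2 * ‖p‖ ^ 2) ≤ h * (κ⁻¹ / 2 * (η ^ 2 * P)) := by
    have e : (2 * Λ * κ)⁻¹ * (η ^ 2 * (Λ * P)) = κ⁻¹ / 2 * (η ^ 2 * P) := by
      field_simp
    calc _ ≤ (2 * Λ * κ)⁻¹ * (η ^ 2 * (Λ * P)) := by gcongr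
      _ = 1 * (κ⁻¹ / 2 * (η ^ 2 * P)) := by rw [e, one_mul]
      _ ≤ _ := by gcongr
  have s2 : h * (2 * κ * Q + 4 * η ^ 2) ≤ M * (κ * (4 * η ^ 2 + 2 * Λ * ‖q‖ ^ 2)) := by
    have t : 2 * κ * Q + 4 * η ^ 2 ≤ κ * (4 * η ^ 2 + 2 * Λ * ‖q‖ ^ 2) := by
      have t1 := mul_le_mul_of_nonneg_left hQu hκ0.le
      have t2 := mul_le_mul_of_nonneg_right hκ (sq_nonneg η)
      nlinarith
    calc _ ≤ h * (κ * (4 * η ^ 2 + 2 * Λ * ‖q‖ ^ 2)) := by gcongr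
      _ ≤ _ := by gcongr
  have s3 := mul_nonneg (by linarith : 0 ≤ h) hc
  nlinarith

theorem gradient_coord {n : ℕ} (φ : EuclideanSpace ℝ (Fin n) → ℝ) (x : EuclideanSpace ℝ (Fin n))
    (i : Fin n) : gradient φ x i = fderiv ℝ φ x (EuclideanSpace.single i 1) := by
  have : inner ℝ (gradient φ x) (EuclideanSpace.single i (1:ℝ))
      = fderiv ℝ φ x (EuclideanSpace.single i 1) := by
    simp [gradient]
  rw [← this, EuclideanSpace.inner_single_right]
  simp

theorem norm_gradient_eq {n : ℕ} (φ : EuclideanSpace ℝ (Fin n) → ℝ)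
    (x : EuclideanSpace ℝ (Fin n)) : ‖gradient φ x‖ = ‖fderiv ℝ φ x‖ := by
  simp [gradient]

/-- **Interior energy (Caccioppoli-type) estimate** (the estimate `(4.22)` in the proof of
Theorem 4.3): there is a constant `C > 0` depending only on `n` and `Λ` such that every
solution `φ` satisfies `∫_{B_{3/4}} |∇φ|² ≤ C κ² e^{2Λκ}`. -/
theorem interior_energy_estimate (n : ℕ) (hn : 2 ≤ n) (Λ : ℝ) (hΛ : 1 ≤ Λ) :
    ∃ C > (0:ℝ),
      ∀ κ : ℝ, 1 ≤ κ →
      ∀ (a : Fin n → Fin n → EuclideanSpace ℝ (Fin n) → ℝ → ℝ)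
        (ρ : EuclideanSpace ℝ (Fin n) → ℝ → ℝ)
        (f : EuclideanSpace ℝ (Fin n) → ℝ)
        (F : EuclideanSpace ℝ (Fin n) → ℝ → EuclideanSpace ℝ (Fin n) → ℝ),
        GoodCoeffs n Λ a ρ f F →
        ∀ φ : EuclideanSpace ℝ (Fin n) → ℝ, IsSolution n κ a ρ f F φ →
          (∫ x in ball (0 : EuclideanSpace ℝ (Fin n)) (3/4), ‖gradient φ x‖ ^ 2)
            ≤ C * κ ^ 2 * Real.exp (2 * Λ * κ) := by
  have hΛ0 : 0 < Λ := by linarith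
  let η : ContDiffBump (0 : EuclideanSpace ℝ (Fin n)) := ⟨3 / 4, 7 / 8, by norm_num, by norm_num⟩
  have hη : ContDiff ℝ 1 η := η.contDiff
  have hηc : Continuous η := η.continuous
  have hηd : Continuous (gradient η) :=
    (LinearIsometryEquiv.continuous _).comp (hη.continuous_fderiv (by norm_num))
  have hηts : tsupport η = closedBall 0 (7 / 8) := η.tsupport_eq
  have hη0 : ∀ x, x ∉ closedBall (0 : EuclideanSpace ℝ (Fin n)) (7 / 8) → η x = 0 := fun x hx =>
    image_eq_zero_of_notMem_tsupport (by rwa [hηts])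
  have hηd0 : ∀ x, x ∉ closedBall (0 : EuclideanSpace ℝ (Fin n)) (7 / 8) →
      gradient η x = 0 := fun x hx => by
    have : fderiv ℝ η x = 0 := image_eq_zero_of_notMem_tsupport
      fun h => hx (hηts ▸ tsupport_fderiv_subset ℝ h)
    simp [gradient, this]
  set W : EuclideanSpace ℝ (Fin n) → ℝ := fun x => 4 * η x ^ 2 + 2 * Λ * ‖gradient η x‖ ^ 2 with hW
  have hWc : Continuous W := by fun_prop
  have hWi : IntegrableOn W (ball 0 1) := integrableOn_ball_of_support W hWc.continuousOn (7 / 8)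
    (by norm_num) fun x hx => by simp [hW, hη0 x hx, hηd0 x hx]
  set C0 := ∫ x in ball (0 : EuclideanSpace ℝ (Fin n)) 1, W x with hC0
  have hC0' : 0 ≤ C0 := integral_nonneg fun x => by simp only [hW]; positivity
  refine ⟨2 * Λ * Real.exp 1 * C0 + 1, by positivity, ?_⟩
  rintro κ hκ a ρ f F ⟨ha, hasym, hell, hρ, hρb, hf, hfb, hF, hFb⟩ φ ⟨hφ, hφb, hweak⟩
  have hκ0 : 0 < κ := by linarith
  have hφc : ContinuousOn φ (ball 0 1) := hφ.continuousOn
  have hφd : ContinuousOn (fderiv ℝ φ) (ball 0 1) :=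
    hφ.continuousOn_fderiv_of_isOpen isOpen_ball (by norm_num)
  have hφg : ContinuousOn (gradient φ) (ball 0 1) :=
    (LinearIsometryEquiv.continuous _).comp_continuousOn hφd
  set V : Fin n → EuclideanSpace ℝ (Fin n) → ℝ := fun j x =>
    ∑ i : Fin n, a i j x (φ x) * gradient φ x i with hVdef
  set g : EuclideanSpace ℝ (Fin n) → ℝ := fun x =>
    ρ x (φ x) * (1 - (1/2) * f x * Real.exp (φ x) + F x (φ x) (gradient φ x)) with hgdef
  have hV : ∀ j, ContinuousOn (V j) (ball 0 1) := by
    intro j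
    refine continuousOn_finsetSum _ fun i _ => ContinuousOn.mul ?_ ?_
    · exact (ha i j).comp (continuousOn_id.prodMk hφc) fun x hx => ⟨hx, mem_univ _⟩
    · simp_rw [gradient_coord]
      exact hφd.clm_apply continuousOn_const
  have hg : ContinuousOn g (ball 0 1) := by
    refine ContinuousOn.mul ?_ (ContinuousOn.add (continuousOn_const.sub
      ((continuousOn_const.mul hf).mul (Real.continuous_exp.comp_continuousOn hφc))) ?_)
    · exact hρ.comp (continuousOn_id.prodMk hφc) fun x hx => ⟨hx, mem_univ _⟩
    · exact hF.comp (continuousOn_id.prodMk (hφc.prodMk hφg)) fun x hx => ⟨hx, mem_univ _⟩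
  set lam := 2 * Λ + κ⁻¹ with hlam
  have hlam0 : 0 < lam := by positivity
  set ψ : EuclideanSpace ℝ (Fin n) → ℝ := fun x => η x ^ 2 * Real.exp (lam * φ x) with hψdef
  have hψ0 : ∀ x, x ∉ closedBall (0 : EuclideanSpace ℝ (Fin n)) (7 / 8) → ψ x = 0 :=
    fun x hx => by simp [hψdef, hη0 x hx]
  have hψsupp : Function.support ψ ⊆ closedBall 0 (7 / 8) := fun x hx => by
    by_contra h; exact hx (hψ0 x h)
  have hψ : ContDiff ℝ 1 ψ := by
    rw [contDiff_iff_contDiffAt]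
    intro x
    by_cases hx : x ∈ closedBall (0 : EuclideanSpace ℝ (Fin n)) (7 / 8)
    · have hx1 : x ∈ ball (0 : EuclideanSpace ℝ (Fin n)) 1 :=
        closedBall_subset_ball (by norm_num) hx
      have := hφ.contDiffAt (isOpen_ball.mem_nhds hx1)
      exact (hη.contDiffAt.pow 2).mul (contDiffAt_const.mul this).exp
    · have : ψ =ᶠ[nhds x] fun _ => 0 := by
        filter_upwards [isClosed_closedBall.isOpen_compl.mem_nhds hx] with y hy using hψ0 y hy
      exact contDiffAt_const.congr_of_eventuallyEq this
  have hψg : ∀ x ∈ ball (0 : EuclideanSpace ℝ (Fin n)) 1, ∀ j,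
      fderiv ℝ ψ x (EuclideanSpace.single j 1) = Real.exp (lam * φ x) *
        (lam * η x ^ 2 * gradient φ x j + 2 * η x * gradient η x j) := by
    intro x hx j
    have d1 : HasFDerivAt φ (fderiv ℝ φ x) x :=
      ((hφ.contDiffAt (isOpen_ball.mem_nhds hx)).differentiableAt (by norm_num)).hasFDerivAt
    have d2 : HasFDerivAt η (fderiv ℝ η x) x :=
      (hη.contDiffAt.differentiableAt (by norm_num)).hasFDerivAt
    have d3 := ((d2.pow 2).mul (d1.const_mul lam).exp).fderiv
    rw [gradient_coord, gradient_coord]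
    have d4 : fderiv ℝ ψ x = _ := d3
    rw [d4]
    simp
    ring
  have hw := weak_form_C1 V g hV hg ?_ ψ hψ (7 / 8) (by norm_num) hψsupp
  swap
  · intro v h1 h2 h3
    rw [← hweak v h1 h2 h3]
    congr 1
    funext x
    rw [Finset.sum_comm]
    refine Finset.sum_congr rfl fun j _ => ?_
    simp only [hVdef, Finset.sum_mul, gradient_coord]
  set M := Real.exp (2 * Λ * κ + 1) with hM
  have hpt : ∀ x ∈ ball (0 : EuclideanSpace ℝ (Fin n)) 1,
      (2 * Λ * κ)⁻¹ * (η x ^ 2 * ‖gradient φ x‖ ^ 2) - M * (κ * W x) ≤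
      (∑ j : Fin n, V j x * fderiv ℝ ψ x (EuclideanSpace.single j 1)) - g x * ψ x := by
    intro x hx
    simp_rw [hψg x hx]
    refine pointwise_bound Λ hΛ (fun i j => a i j x (φ x)) (fun i j => hasym i j x (φ x))
      (hell x hx (φ x)) (gradient φ x) (gradient η x) (η x) κ (Real.exp (lam * φ x)) M (g x)
      hκ ?_ ?_ ?_
    · exact Real.one_le_exp (mul_nonneg hlam0.le (hφb x hx).1)
    · refine Real.exp_le_exp.2 ?_
      calc lam * φ x ≤ lam * κ := by gcongr; exact (hφb x hx).2
        _ = 2 * Λ * κ + 1 := by rw [hlam]; field_simp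
    · have hr := hρb x hx (φ x)
      have hFF := (abs_le.1 (hFb x hx (φ x) (gradient φ x))).2
      have hff : 0 ≤ (1/2) * f x * Real.exp (φ x) :=
        mul_nonneg (by linarith [(hfb x hx).1]) (Real.exp_pos _).le
      calc g x ≤ ρ x (φ x) * (2 + ‖gradient φ x‖ ^ 2) := by
            refine mul_le_mul_of_nonneg_left ?_ (by linarith)
            linarith
        _ ≤ 2 * (2 + ‖gradient φ x‖ ^ 2) := by gcongr; exact hr.2
        _ = _ := by ring
  have hUi : IntegrableOn (fun x => η x ^ 2 * ‖gradient φ x‖ ^ 2) (ball 0 1) :=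
    integrableOn_ball_of_support _ ((hηc.pow 2).continuousOn.mul (hφg.norm.pow 2)) (7 / 8)
      (by norm_num) fun x hx => by simp [hη0 x hx]
  have hLi : IntegrableOn (fun x => ∑ j : Fin n, V j x *
      fderiv ℝ ψ x (EuclideanSpace.single j 1)) (ball 0 1) := by
    refine integrableOn_ball_of_support _ (continuousOn_finsetSum _ fun j _ => (hV j).mul
      ((hψ.continuous_fderiv (by norm_num)).clm_apply continuous_const).continuousOn) (7 / 8)
      (by norm_num) fun x hx => ?_
    have : fderiv ℝ ψ x = 0 := image_eq_zero_of_notMem_tsupport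
      fun h => hx (closure_minimal hψsupp isClosed_closedBall (tsupport_fderiv_subset ℝ h))
    simp [this]
  have hRi : IntegrableOn (fun x => g x * ψ x) (ball 0 1) :=
    integrableOn_ball_of_support _ (hg.mul hψ.continuous.continuousOn) (7 / 8)
      (by norm_num) fun x hx => by simp [hψ0 x hx]
  have hint := setIntegral_mono_on ((hUi.const_mul _).sub ((hWi.const_mul κ).const_mul M))
    (hLi.sub hRi) measurableSet_ball hpt
  simp only [Pi.sub_apply] at hint
  rw [integral_sub (hUi.const_mul _) ((hWi.const_mul κ).const_mul M), integral_sub hLi hRi, hw,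
    sub_self, integral_const_mul, integral_const_mul, integral_const_mul, ← hC0] at hint
  have hle : (∫ x in ball (0 : EuclideanSpace ℝ (Fin n)) (3/4), ‖gradient φ x‖ ^ 2) ≤
      ∫ x in ball (0 : EuclideanSpace ℝ (Fin n)) 1, η x ^ 2 * ‖gradient φ x‖ ^ 2 := by
    calc _ = ∫ x in ball (0 : EuclideanSpace ℝ (Fin n)) (3/4), η x ^ 2 * ‖gradient φ x‖ ^ 2 := by
          refine setIntegral_congr_fun measurableSet_ball fun x hx => ?_
          have : η x = 1 := η.one_of_mem_closedBall (ball_subset_closedBall hx)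
          simp [this]
      _ ≤ _ := setIntegral_mono_set hUi (Filter.Eventually.of_forall fun x => by positivity)
          (ball_subset_ball (by norm_num)).eventuallyLE
  refine hle.trans ?_
  have h1 : (2 * Λ * κ)⁻¹ * (∫ x in ball (0 : EuclideanSpace ℝ (Fin n)) 1,
      η x ^ 2 * ‖gradient φ x‖ ^ 2) ≤ M * (κ * C0) := by linarith
  rw [inv_mul_le_iff₀ (by positivity)] at h1
  refine h1.trans ?_
  rw [hM, Real.exp_add]
  have : 0 ≤ κ ^ 2 * Real.exp (2 * Λ * κ) := by positivity
  nlinarith
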